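/- Let μ be a unit pure quaternion. Every third-order quaternion tensor A ∈ ℍ^{n₁×n₂×n₃} can be factorized as A = U *_μ S *_μ V*, where U ∈ ℍ^{n₁×n₁×n₃} and V ∈ ℍ^{n₂×n₂×n₃} are unitary tensors and S ∈ ℍ^{n₁×n₂×n₃} is f-diagonal; moreover ‖A‖_F = ‖S‖_F, and U, S, V can be chosen so that every frontal slice of fft(S) is a real nonnegative diagonal matrix with nonincreasing diagonal entries. -/

import Mathlib

noncomputable section
open Matrix Kronecker Filter Topology

namespace QTpaper

/-- The quaternion unit `i`. -/
def qi : Quaternion ℝ := ⟨0, 1, 0, 0⟩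
/-- The quaternion unit `j`. -/
def qj : Quaternion ℝ := ⟨0, 0, 1, 0⟩
/-- The quaternion unit `k`. -/
def qk : Quaternion ℝ := ⟨0, 0, 0, 1⟩

/-- A unit pure quaternion: zero real part and norm one. -/
def UnitPure (μ : Quaternion ℝ) : Prop := μ.re = 0 ∧ ‖μ‖ = 1

/-- Third-order quaternion tensors. -/
abbrev QTensor (a b c : ℕ) := Fin a → Fin b → Fin c → Quaternion ℝ

/-- `l`-th frontal slice of a third-order tensor. -/
def fslice {a b c : ℕ} (A : QTensor a b c) (l : Fin c) :
    Matrix (Fin a) (Fin b) (Quaternion ℝ) := fun p q => A p q l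

/-- Frobenius norm of a quaternion matrix. -/
def frobM {m n : ℕ} (A : Matrix (Fin m) (Fin n) (Quaternion ℝ)) : ℝ :=
  Real.sqrt (∑ p, ∑ q, ‖A p q‖ ^ 2)

/-- Frobenius norm of a third-order quaternion tensor. -/
def frobT {a b c : ℕ} (A : QTensor a b c) : ℝ :=
  Real.sqrt (∑ p, ∑ q, ∑ l, ‖A p q l‖ ^ 2)

/-- The normalized QDFT matrix `F_{μ,n}` with entries
`(1/√n)·ω^{(p-1)(q-1)}`, `ω^m = cos(2πm/n) − μ·sin(2πm/n)`. -/
def Fq (μ : Quaternion ℝ) (n : ℕ) : Matrix (Fin n) (Fin n) (Quaternion ℝ) :=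
  fun p q =>
    ((1 / Real.sqrt n : ℝ) : Quaternion ℝ) *
      (((Real.cos (2 * Real.pi * (p.1 * q.1) / n) : ℝ) : Quaternion ℝ)
        - ((Real.sin (2 * Real.pi * (p.1 * q.1) / n) : ℝ) : Quaternion ℝ) * μ)

/-- The permutation matrix `P_n` (1-based: `P₁₁ = 1`, `P_{pq} = 1` for `p+q = n+2`). -/
def Pmat (n : ℕ) : Matrix (Fin n) (Fin n) ℝ :=
  fun p q => if (p.1 = 0 ∧ q.1 = 0) ∨ (p.1 + q.1 = n) then 1 else 0

/-- Block circulant matrix of a third-order tensor. -/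
def circ {a b c : ℕ} (A : QTensor a b c) :
    Matrix (Fin c × Fin a) (Fin c × Fin b) (Quaternion ℝ) :=
  fun pi qj => A pi.2 qj.2 (pi.1 - qj.1)

/-- `unfold` stacks the frontal slices vertically. -/
def unfold3 {a b c : ℕ} (A : QTensor a b c) :
    Matrix (Fin c × Fin a) (Fin b) (Quaternion ℝ) :=
  fun pi q => A pi.2 q pi.1

/-- `fold` is the inverse of `unfold`. -/
def fold3 {a b c : ℕ} (M : Matrix (Fin c × Fin a) (Fin b) (Quaternion ℝ)) :
    QTensor a b c := fun p q l => M (l, p) q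

/-- Block diagonal matrix whose `l`-th diagonal block is the `l`-th frontal slice. -/
def diagT {a b c : ℕ} (A : QTensor a b c) :
    Matrix (Fin c × Fin a) (Fin c × Fin b) (Quaternion ℝ) :=
  fun pi qj => if pi.1 = qj.1 then A pi.2 qj.2 pi.1 else 0

/-- The QDFT along mode 3: `fft(A)(p,q,:) = √n₃ · F_{μ,n₃} · A(p,q,:)`. -/
def fftT {a b c : ℕ} (μ : Quaternion ℝ) (A : QTensor a b c) : QTensor a b c :=
  fun p q l => ((Real.sqrt c : ℝ) : Quaternion ℝ) * ∑ m, Fq μ c l m * A p q m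

/-- Real-part component tensor. -/
def compE {a b c : ℕ} (A : QTensor a b c) : QTensor a b c :=
  fun p q l => (((A p q l).re : ℝ) : Quaternion ℝ)
/-- `i`-component tensor. -/
def compI {a b c : ℕ} (A : QTensor a b c) : QTensor a b c :=
  fun p q l => (((A p q l).imI : ℝ) : Quaternion ℝ)
/-- `j`-component tensor. -/
def compJ {a b c : ℕ} (A : QTensor a b c) : QTensor a b c :=
  fun p q l => (((A p q l).imJ : ℝ) : Quaternion ℝ)
/-- `k`-component tensor. -/
def compK {a b c : ℕ} (A : QTensor a b c) : QTensor a b c :=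
  fun p q l => (((A p q l).imK : ℝ) : Quaternion ℝ)

/-- For `μ = a·i + b·j + c·k`, `μ_i = a·i − b·j − c·k`. -/
def mui (μ : Quaternion ℝ) : Quaternion ℝ := ⟨0, μ.imI, -μ.imJ, -μ.imK⟩
/-- For `μ = a·i + b·j + c·k`, `μ_j = −a·i + b·j − c·k`. -/
def muj (μ : Quaternion ℝ) : Quaternion ℝ := ⟨0, -μ.imI, μ.imJ, -μ.imK⟩
/-- For `μ = a·i + b·j + c·k`, `μ_k = −a·i − b·j + c·k`. -/
def muk (μ : Quaternion ℝ) : Quaternion ℝ := ⟨0, -μ.imI, -μ.imJ, μ.imK⟩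

/-- `T` matrix `F_{ν,n}^* · F_{μ,n}`. -/
def Tm (ν μ : Quaternion ℝ) (n : ℕ) : Matrix (Fin n) (Fin n) (Quaternion ℝ) :=
  (Fq ν n)ᴴ * Fq μ n

/-- The gQt-product of third-order quaternion tensors. -/
def gQt {n₁ r n₂ n₃ : ℕ} (μ : Quaternion ℝ) (A : QTensor n₁ r n₃)
    (B : QTensor r n₂ n₃) : QTensor n₁ n₂ n₃ :=
  fold3 ((circ (compE A)
      + qi • (circ (compI A) * (Tm (mui μ) μ n₃ ⊗ₖ (1 : Matrix (Fin r) (Fin r) (Quaternion ℝ))))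
      + qj • (circ (compJ A) * (Tm (muj μ) μ n₃ ⊗ₖ (1 : Matrix (Fin r) (Fin r) (Quaternion ℝ))))
      + qk • (circ (compK A) * (Tm (muk μ) μ n₃ ⊗ₖ (1 : Matrix (Fin r) (Fin r) (Quaternion ℝ)))))
    * unfold3 B)

/-- The index reversal `1 ↦ 1`, `l ↦ n₃ + 2 − l` (1-based), used in the tensor transpose. -/
def revIdx {c : ℕ} (l : Fin c) : Fin c :=
  if h : l.1 = 0 then l else ⟨c - l.1, by have := l.2; omega⟩

/-- Transpose of a (componentwise real) tensor: transpose each frontal slice and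
reverse the order of the transposed slices `2` through `n₃`. -/
def transT {a b c : ℕ} (A : QTensor a b c) : QTensor b a c :=
  fun q p l => A p q (revIdx l)

/-- Right multiplication of a matrix by a quaternion scalar. -/
def rmulM {m n : Type*} (M : Matrix m n (Quaternion ℝ)) (x : Quaternion ℝ) :
    Matrix m n (Quaternion ℝ) := fun p q => M p q * x

/-- Conjugate transpose of a third-order quaternion tensor. -/
def conjT {n₁ n₂ n₃ : ℕ} (μ : Quaternion ℝ) (A : QTensor n₁ n₂ n₃) : QTensor n₂ n₁ n₃ :=
  fold3 (unfold3 (transT (compE A))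
    - rmulM (((Tm (mui μ) μ n₃)ᴴ ⊗ₖ (1 : Matrix (Fin n₂) (Fin n₂) (Quaternion ℝ)))
        * unfold3 (transT (compI A))) qi
    - rmulM (((Tm (muj μ) μ n₃)ᴴ ⊗ₖ (1 : Matrix (Fin n₂) (Fin n₂) (Quaternion ℝ)))
        * unfold3 (transT (compJ A))) qj
    - rmulM (((Tm (muk μ) μ n₃)ᴴ ⊗ₖ (1 : Matrix (Fin n₂) (Fin n₂) (Quaternion ℝ)))
        * unfold3 (transT (compK A))) qk)

/-- The identity tensor: first frontal slice is the identity, the others vanish. -/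
def idT (n l : ℕ) : QTensor n n l :=
  fun p q m => if m.1 = 0 ∧ p = q then 1 else 0

/-- Unitary tensor with respect to the gQt-product. -/
def unitaryT {n n₃ : ℕ} (μ : Quaternion ℝ) (U : QTensor n n n₃) : Prop :=
  gQt μ (conjT μ U) U = idT n n₃ ∧ gQt μ U (conjT μ U) = idT n n₃

/-- f-diagonal tensor: each frontal slice is a diagonal matrix. -/
def fDiag {a b c : ℕ} (S : QTensor a b c) : Prop :=
  ∀ p q l, p.1 ≠ q.1 → S p q l = 0


section QuaternionSVD

open Quaternion

@[simp] lemma re_qi : qi.re = 0 := rfl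
@[simp] lemma imI_qi : qi.imI = 1 := rfl
@[simp] lemma imJ_qi : qi.imJ = 0 := rfl
@[simp] lemma imK_qi : qi.imK = 0 := rfl
@[simp] lemma re_qj : qj.re = 0 := rfl
@[simp] lemma imI_qj : qj.imI = 0 := rfl
@[simp] lemma imJ_qj : qj.imJ = 1 := rfl
@[simp] lemma imK_qj : qj.imK = 0 := rfl
@[simp] lemma re_qk : qk.re = 0 := rfl
@[simp] lemma imI_qk : qk.imI = 0 := rfl
@[simp] lemma imJ_qk : qk.imJ = 0 := rfl
@[simp] lemma imK_qk : qk.imK = 1 := rfl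

lemma star_qi : star qi = -qi := by ext <;> simp
lemma star_qj : star qj = -qj := by ext <;> simp
lemma star_qk : star qk = -qk := by ext <;> simp
lemma qi_mul_qi : qi * qi = -1 := by ext <;> simp
lemma qj_mul_qj : qj * qj = -1 := by ext <;> simp
lemma qk_mul_qk : qk * qk = -1 := by ext <;> simp

/-- Real part of the trace of a quaternion matrix. -/
def reTr {m : Type*} [Fintype m] (M : Matrix m m ℍ[ℝ]) : ℝ := ∑ p, (M p p).re

lemma re_sum {ι : Type*} (s : Finset ι) (f : ι → ℍ[ℝ]) : (∑ i ∈ s, f i).re = ∑ i ∈ s, (f i).re :=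
  map_sum (QuaternionAlgebra.reₗ (R := ℝ) (-1) 0 (-1)) f s

lemma re_mul_comm (x y : ℍ[ℝ]) : (x * y).re = (y * x).re := by
  simp only [Quaternion.re_mul]; ring

lemma reTr_add {m : Type*} [Fintype m] (M N : Matrix m m ℍ[ℝ]) :
    reTr (M + N) = reTr M + reTr N := by
  simp [reTr, Finset.sum_add_distrib]

lemma reTr_smul {m : Type*} [Fintype m] (a : ℝ) (M : Matrix m m ℍ[ℝ]) :
    reTr (a • M) = a * reTr M := by
  simp [reTr, Finset.mul_sum]

lemma reTr_mul_comm {m n : Type*} [Fintype m] [Fintype n]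
    (M : Matrix m n ℍ[ℝ]) (N : Matrix n m ℍ[ℝ]) : reTr (M * N) = reTr (N * M) := by
  simp only [reTr, Matrix.mul_apply, re_sum]
  rw [Finset.sum_comm]
  simp only [re_mul_comm]

lemma reTr_single_mul {m : Type*} [Fintype m] [DecidableEq m] (p q : m) (u : ℍ[ℝ])
    (N : Matrix m m ℍ[ℝ]) : reTr (single p q u * N) = (u * N q p).re := by
  unfold reTr
  rw [Finset.sum_eq_single p]
  · simp
  · intro b _ hb
    simp [Matrix.single_mul_apply_of_ne _ _ _ _ _ hb]
  · simp

/-- Rotations generated by a skew-adjoint `X` with `X³ = -X` are unitary. -/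
lemma rotation_mem_unitary {R : Type*} [Ring R] [StarRing R] [Algebra ℝ R] [StarModule ℝ R]
    {X : R} (hX : star X = -X) (hX3 : X * X * X = -X) {s c : ℝ} (hsc : s ^ 2 + c ^ 2 = 1) :
    1 + s • X + (1 - c) • (X * X) ∈ unitary R := by
  have hX4 : X * X * (X * X) = -(X * X) := by rw [← mul_assoc, hX3, neg_mul]
  have hX3' : X * (X * X) = -X := by rw [← mul_assoc, hX3]
  have hstar : star (1 + s • X + (1 - c) • (X * X)) = 1 - s • X + (1 - c) • (X * X) := by
    simp [hX, sub_eq_add_neg]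
  have hc : (2 * (1 - c) - s ^ 2 - (1 - c) ^ 2) = 0 := by linarith
  rw [Unitary.mem_iff, hstar]
  constructor
  · calc _ = 1 + (2 * (1 - c) - s ^ 2 - (1 - c) ^ 2) • (X * X) := by
          simp only [add_mul, mul_add, sub_mul, smul_mul_assoc, mul_smul_comm, hX4, hX3, hX3',
            one_mul, mul_one]
          module
      _ = 1 := by rw [hc]; simp
  · calc _ = 1 + (2 * (1 - c) - s ^ 2 - (1 - c) ^ 2) • (X * X) := by
          simp only [add_mul, mul_add, mul_sub, smul_mul_assoc, mul_smul_comm, hX4, hX3, hX3',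
            one_mul, mul_one]
          module
      _ = 1 := by rw [hc]; simp

lemma eq_zero_of_trig_le {a b : ℝ}
    (h : ∀ s c : ℝ, s ^ 2 + c ^ 2 = 1 → s * a + (1 - c) * b ≤ 0) : a = 0 := by
  by_contra ha
  have key : ∀ t : ℝ, t * a + t ^ 2 * b ≤ 0 := fun t => by
    have ht : 0 < 1 + t ^ 2 := by positivity
    have := h (2 * t / (1 + t ^ 2)) ((1 - t ^ 2) / (1 + t ^ 2)) (by field_simp; ring)
    have h2 : 2 * t / (1 + t ^ 2) * a + (1 - (1 - t ^ 2) / (1 + t ^ 2)) * b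
        = 2 / (1 + t ^ 2) * (t * a + t ^ 2 * b) := by field_simp; ring
    rw [h2] at this
    exact nonpos_of_mul_nonpos_right this (by positivity)
  have h1 := key (a / (1 + |b|))
  have hb : 0 < 1 + |b| := by positivity
  have h2 : a / (1 + |b|) * a + (a / (1 + |b|)) ^ 2 * b
      = a ^ 2 * (1 + (|b| + b)) / (1 + |b|) ^ 2 := by field_simp; ring
  have h3 : 0 ≤ |b| + b := by linarith [neg_abs_le b]
  have h4 : 0 < a ^ 2 * (1 + (|b| + b)) / (1 + |b|) ^ 2 := by positivity
  linarith

instance : StarModule ℝ ℍ[ℝ] := ⟨fun r x => by simp⟩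

lemma reTr_skew_mul_eq_zero {m : Type*} [Fintype m] [DecidableEq m] {N X : Matrix m m ℍ[ℝ]}
    (hN : ∀ W ∈ unitary (Matrix m m ℍ[ℝ]), reTr (W * N) ≤ reTr N)
    (hX : star X = -X) (hX3 : X * X * X = -X) : reTr (X * N) = 0 := by
  refine eq_zero_of_trig_le (b := reTr (X * X * N)) fun s c hsc => ?_
  have := hN _ (rotation_mem_unitary hX hX3 hsc)
  simp only [add_mul, one_mul, smul_mul_assoc, reTr_add, reTr_smul] at this
  linarith

/-- If the identity maximizes `W ↦ Re tr (W N)` over the unitary matrices, `N` is Hermitian. -/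
lemma conjTranspose_eq_of_reTr_le {m : Type*} [Fintype m] [DecidableEq m] {N : Matrix m m ℍ[ℝ]}
    (hN : ∀ W ∈ unitary (Matrix m m ℍ[ℝ]), reTr (W * N) ≤ reTr N) : Nᴴ = N := by
  have hdiag : ∀ p (u : ℍ[ℝ]), star u = -u → u * u = -1 → (u * N p p).re = 0 := by
    intro p u hu hu2
    rw [← reTr_single_mul]
    refine reTr_skew_mul_eq_zero hN ?_ ?_
    · rw [star_eq_conjTranspose, conjTranspose_single, hu, single_neg]
    · simp [hu2, ← single_neg]
  have hoff : ∀ p q (u : ℍ[ℝ]), p ≠ q → star u * u = 1 → u * star u = 1 →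
      (u * (N q p - star (N p q))).re = 0 := by
    intro p q u hpq hu hu'
    have := reTr_skew_mul_eq_zero hN (X := single p q u - single q p (star u)) ?_ ?_
    · rw [sub_eq_add_neg, add_mul, reTr_add, single_neg, reTr_single_mul, reTr_single_mul] at this
      simp [Quaternion.re_mul] at this ⊢
      linarith
    · simp [star_eq_conjTranspose]
    · simp [mul_sub, sub_mul, hpq, hpq.symm, hu, hu']
      abel
  apply Matrix.ext
  intro p q
  rw [conjTranspose_apply]
  by_cases hpq : p = q
  · subst hpq
    have h1 := hdiag p qi star_qi qi_mul_qi
    have h2 := hdiag p qj star_qj qj_mul_qj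
    have h3 := hdiag p qk star_qk qk_mul_qk
    simp [Quaternion.re_mul] at h1 h2 h3
    ext <;> simp <;> linarith
  · have h0 := hoff q p 1 (Ne.symm hpq) (by simp) (by simp)
    have h1 := hoff q p qi (Ne.symm hpq) (by simp [star_qi, qi_mul_qi]) (by simp [star_qi, qi_mul_qi])
    have h2 := hoff q p qj (Ne.symm hpq) (by simp [star_qj, qj_mul_qj]) (by simp [star_qj, qj_mul_qj])
    have h3 := hoff q p qk (Ne.symm hpq) (by simp [star_qk, qk_mul_qk]) (by simp [star_qk, qk_mul_qk])
    simp [Quaternion.re_mul] at h0 h1 h2 h3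
    ext <;> simp <;> linarith

lemma diag_re_nonneg_of_reTr_le {m : Type*} [Fintype m] [DecidableEq m] {N : Matrix m m ℍ[ℝ]}
    (hN : ∀ W ∈ unitary (Matrix m m ℍ[ℝ]), reTr (W * N) ≤ reTr N) (p : m) : 0 ≤ (N p p).re := by
  have h := hN (1 - (2 : ℝ) • single p p 1) ?_
  · rw [sub_eq_add_neg, ← neg_smul, add_mul, reTr_add, one_mul, smul_mul_assoc, reTr_smul,
      reTr_single_mul, one_mul] at h
    linarith
  · have hs : star (1 - (2 : ℝ) • single p p (1 : ℍ[ℝ])) = 1 - (2 : ℝ) • single p p 1 := by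
      simp [star_eq_conjTranspose]
    have h1 : (1 - (2 : ℝ) • single p p (1 : ℍ[ℝ])) * (1 - (2 : ℝ) • single p p 1) = 1 := by
      simp only [mul_sub, sub_mul, smul_mul_assoc, mul_smul_comm, one_mul, mul_one,
        single_mul_single_same]
      module
    rw [Unitary.mem_iff, hs]
    exact ⟨h1, h1⟩

/-- The quaternionic unitary group is compact. -/
lemma isCompact_unitary (m : Type*) [Fintype m] [DecidableEq m] :
    IsCompact (unitary (Matrix m m ℍ[ℝ]) : Set (Matrix m m ℍ[ℝ])) := by
  have hK : IsCompact (Set.univ.pi fun _ : m => Set.univ.pi fun _ : m =>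
      Metric.closedBall (0 : ℍ[ℝ]) 1) :=
    isCompact_univ_pi fun _ => isCompact_univ_pi fun _ => isCompact_closedBall _ _
  refine hK.of_isClosed_subset ?_ ?_
  · have : (unitary (Matrix m m ℍ[ℝ]) : Set (Matrix m m ℍ[ℝ]))
        = {W | star W * W = 1} ∩ {W | W * star W = 1} := by
      ext W; exact Unitary.mem_iff
    rw [this]
    exact (isClosed_eq (by fun_prop) continuous_const).inter
      (isClosed_eq (by fun_prop) continuous_const)
  · refine fun (W : Matrix m m ℍ[ℝ]) (hW : W ∈ unitary (Matrix m m ℍ[ℝ])) p _ q _ => ?_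
    have h := congrArg (fun M : Matrix m m ℍ[ℝ] => (M q q).re) (Unitary.mem_iff.1 hW).1
    simp only [star_eq_conjTranspose, mul_apply, conjTranspose_apply, re_sum, one_apply_eq,
      Quaternion.star_mul_self, Quaternion.re_coe, Quaternion.re_one] at h
    have h1 : Quaternion.normSq (W p q) ≤ 1 := h ▸ Finset.single_le_sum
      (f := fun r => Quaternion.normSq (W r q)) (fun _ _ => Quaternion.normSq_nonneg)
      (Finset.mem_univ p)
    rw [Quaternion.normSq_eq_norm_mul_self] at h1
    rw [mem_closedBall_zero_iff]
    nlinarith [norm_nonneg (W p q)]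

/-- Rectangular diagonal matrix with the strictly decreasing positive weights `1 / (p + 1)`. -/
def weightMat (m n : ℕ) : Matrix (Fin m) (Fin n) ℍ[ℝ] :=
  fun p q => if p.1 = q.1 then (p.1 + 1 : ℝ)⁻¹ • (1 : ℍ[ℝ]) else 0

lemma weightMat_conjTranspose (m n : ℕ) : (weightMat m n)ᴴ = weightMat n m := by
  apply Matrix.ext
  intro q p
  rw [conjTranspose_apply]
  unfold weightMat
  by_cases h : p.1 = q.1
  · simp [h]
  · simp [h, Ne.symm h]

lemma mul_weightMat_apply {ι : Type*} {m n : ℕ} (B : Matrix ι (Fin n) ℍ[ℝ]) (p : ι) (q : Fin m) :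
    (B * weightMat n m) p q
      = if h : q.1 < n then ((q.1 + 1 : ℝ)⁻¹) • B p ⟨q.1, h⟩ else 0 := by
  rw [mul_apply]
  split_ifs with h
  · rw [Finset.sum_eq_single ⟨q.1, h⟩]
    · simp [weightMat]
    · intro r _ hr
      have : r.1 ≠ q.1 := fun h' => hr (Fin.ext h')
      simp [weightMat, this]
    · simp
  · refine Finset.sum_eq_zero fun r _ => ?_
    have : r.1 ≠ q.1 := fun h' => h (h' ▸ r.2)
    simp [weightMat, this]

lemma weightMat_mul_apply {ι : Type*} {m n : ℕ} (B : Matrix (Fin n) ι ℍ[ℝ]) (p : Fin m) (q : ι) :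
    (weightMat m n * B) p q
      = if h : p.1 < n then ((p.1 + 1 : ℝ)⁻¹) • B ⟨p.1, h⟩ q else 0 := by
  have h := congrArg star (mul_weightMat_apply (m := m) Bᴴ q p)
  rw [← conjTranspose_apply, conjTranspose_mul, conjTranspose_conjTranspose,
    weightMat_conjTranspose] at h
  rw [h]
  split_ifs <;> simp

/-- Off-diagonal entries vanish when both products with the weight matrix are Hermitian. -/
lemma eq_zero_of_weightMat_hermitian {m n : ℕ} {B : Matrix (Fin m) (Fin n) ℍ[ℝ]}
    (h1 : (B * weightMat n m)ᴴ = B * weightMat n m)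
    (h2 : (weightMat n m * B)ᴴ = weightMat n m * B) (p : Fin m) (q : Fin n) (hpq : p.1 ≠ q.1) :
    B p q = 0 := by
  rw [conjTranspose_mul, weightMat_conjTranspose] at h1 h2
  have h : weightMat m n * (weightMat n m * B) = B * weightMat n m * weightMat m n := by
    rw [← h2, ← Matrix.mul_assoc, h1]
  have h' := congrFun (congrFun h p) q
  simp only [weightMat_mul_apply, mul_weightMat_apply] at h'
  have key : ∀ a b : ℕ, (a + 1 : ℝ)⁻¹ * (a + 1 : ℝ)⁻¹ = (b + 1 : ℝ)⁻¹ * (b + 1 : ℝ)⁻¹ → a = b := by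
    intro a b hab
    have := (mul_self_inj (by positivity) (by positivity)).1 hab
    have := inv_injective this
    exact_mod_cast add_right_cancel this
  by_cases hp : p.1 < n <;> by_cases hq : q.1 < m
  · simp only [hp, hq, dif_pos, Fin.is_lt, smul_smul] at h'
    rw [← sub_eq_zero, ← sub_smul] at h'
    rcases smul_eq_zero.1 h' with h0 | h0
    · exact absurd (key _ _ (sub_eq_zero.1 h0)) hpq
    · exact h0
  · simp only [hp, hq, dif_pos, Fin.is_lt, smul_smul, dif_neg, not_false_eq_true] at h'
    exact (smul_eq_zero.1 h').resolve_left (by positivity)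
  · simp only [hp, hq, dif_pos, Fin.is_lt, smul_smul, dif_neg, not_false_eq_true] at h'
    exact (smul_eq_zero.1 h'.symm).resolve_left (by positivity)
  · exact absurd (p.2.trans_le (not_lt.1 hq)) (by have := q.2; omega)

lemma perm_mem_unitary {m : Type*} [Fintype m] [DecidableEq m] (σ : Equiv.Perm m) :
    (1 : Matrix m m ℍ[ℝ]).submatrix σ id ∈ unitary (Matrix m m ℍ[ℝ]) := by
  rw [Unitary.mem_iff, star_eq_conjTranspose, conjTranspose_submatrix, conjTranspose_one]
  constructor
  · rw [submatrix_mul_equiv]; simp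
  · have := submatrix_mul_equiv (1 : Matrix m m ℍ[ℝ]) (1 : Matrix m m ℍ[ℝ]) σ (Equiv.refl m) σ
    simpa using this

lemma reTr_mul_weightMat {m n : ℕ} (B : Matrix (Fin m) (Fin n) ℍ[ℝ]) :
    reTr (B * weightMat n m)
      = ∑ x : Fin m × Fin n, if x.1.1 = x.2.1 then (x.1.1 + 1 : ℝ)⁻¹ * (B x.1 x.2).re else 0 := by
  rw [Fintype.sum_prod_type]
  unfold reTr
  refine Finset.sum_congr rfl fun p _ => ?_
  rw [mul_apply, re_sum]
  refine Finset.sum_congr rfl fun q _ => ?_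
  unfold weightMat
  by_cases h : p.1 = q.1
  · simp [h]
  · simp [h, Ne.symm h]

/-- Weighted sums detect monotonicity of the diagonal. -/
lemma diag_antitone_of_reTr_le {m n : ℕ} {B : Matrix (Fin m) (Fin n) ℍ[ℝ]}
    (hB : ∀ (σ : Equiv.Perm (Fin m)) (τ : Equiv.Perm (Fin n)),
      reTr (B.submatrix σ τ * weightMat n m) ≤ reTr (B * weightMat n m))
    (p p' : Fin m) (q q' : Fin n) (h : p.1 = q.1) (h' : p'.1 = q'.1) (hle : p.1 ≤ p'.1) :
    (B p' q').re ≤ (B p q).re := by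
  rcases hle.eq_or_lt with heq | hlt
  · have h1 : p = p' := Fin.ext heq
    have h2 : q = q' := Fin.ext (by omega)
    rw [h1, h2]
  have hp : p ≠ p' := fun e => by simp [e] at hlt
  have hq : q ≠ q' := fun e => by subst e; omega
  have key := hB (Equiv.swap p p') (Equiv.swap q q')
  rw [reTr_mul_weightMat, reTr_mul_weightMat, ← sub_nonneg, ← Finset.sum_sub_distrib,
    Finset.sum_eq_add (p, q) (p', q') (by simp [hp])] at key
  · simp only [h, h', if_true, submatrix_apply, Equiv.swap_apply_left, Equiv.swap_apply_right] at key
    have hc : ((q'.1 : ℝ) + 1)⁻¹ < ((q.1 : ℝ) + 1)⁻¹ := by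
      apply inv_strictAnti₀ (by positivity)
      have : (q.1 : ℝ) < q'.1 := by exact_mod_cast (by omega : q.1 < q'.1)
      linarith
    by_contra hlt'
    nlinarith
  · rintro ⟨a, b⟩ _ ⟨h1, h2⟩
    by_cases hab : a.1 = b.1
    · have ha : a ≠ p := fun e => h1 (by subst e; simp; exact Fin.ext (by omega))
      have ha' : a ≠ p' := fun e => h2 (by subst e; simp; exact Fin.ext (by omega))
      have hb : b ≠ q := fun e => ha (Fin.ext (by subst e; omega))
      have hb' : b ≠ q' := fun e => ha' (Fin.ext (by subst e; omega))
      simp [hab, Equiv.swap_apply_of_ne_of_ne ha ha', Equiv.swap_apply_of_ne_of_ne hb hb']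
    · simp [hab]
  · simp
  · simp

/-- Singular value decomposition of a quaternion matrix. -/
theorem exists_quaternion_svd {m n : ℕ} (A : Matrix (Fin m) (Fin n) ℍ[ℝ]) :
    ∃ U ∈ unitary (Matrix (Fin m) (Fin m) ℍ[ℝ]), ∃ S : Matrix (Fin m) (Fin n) ℍ[ℝ],
      ∃ V ∈ unitary (Matrix (Fin n) (Fin n) ℍ[ℝ]), A = U * S * Vᴴ ∧
      (∀ p q, (S p q).imI = 0 ∧ (S p q).imJ = 0 ∧ (S p q).imK = 0) ∧
      (∀ p q, 0 ≤ (S p q).re) ∧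
      (∀ p q, p.1 ≠ q.1 → S p q = 0) ∧
      (∀ p p' q q', p.1 = q.1 → p'.1 = q'.1 → p.1 ≤ p'.1 → (S p' q').re ≤ (S p q).re) := by
  have hcont : Continuous fun x : Matrix (Fin m) (Fin m) ℍ[ℝ] × Matrix (Fin n) (Fin n) ℍ[ℝ] =>
      reTr (x.1 * A * x.2 * weightMat n m) := by
    unfold reTr
    refine continuous_finsetSum _ fun p _ => Quaternion.continuous_re.comp ?_
    have : Continuous fun x : Matrix (Fin m) (Fin m) ℍ[ℝ] × Matrix (Fin n) (Fin n) ℍ[ℝ] =>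
      x.1 * A * x.2 * weightMat n m := by fun_prop
    exact this.matrix_elem p p
  obtain ⟨⟨W, Z⟩, ⟨hW, hZ⟩, hmax⟩ :=
    ((isCompact_unitary (Fin m)).prod (isCompact_unitary (Fin n))).exists_isMaxOn
      ⟨(1, 1), one_mem _, one_mem _⟩ hcont.continuousOn
  replace hW : W ∈ unitary (Matrix (Fin m) (Fin m) ℍ[ℝ]) := hW
  replace hZ : Z ∈ unitary (Matrix (Fin n) (Fin n) ℍ[ℝ]) := hZ
  obtain ⟨B, hB⟩ : ∃ B, B = W * A * Z := ⟨_, rfl⟩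
  have hopt : ∀ W' ∈ unitary (Matrix (Fin m) (Fin m) ℍ[ℝ]),
      ∀ Z' ∈ unitary (Matrix (Fin n) (Fin n) ℍ[ℝ]),
      reTr (W' * B * Z' * weightMat n m) ≤ reTr (B * weightMat n m) := by
    intro W' hW' Z' hZ'
    have := hmax (a := (W' * W, Z * Z')) ⟨mul_mem hW' hW, mul_mem hZ hZ'⟩
    simpa [hB, Matrix.mul_assoc] using this
  have hleft : ∀ W' ∈ unitary (Matrix (Fin m) (Fin m) ℍ[ℝ]),
      reTr (W' * (B * weightMat n m)) ≤ reTr (B * weightMat n m) := fun W' hW' => by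
    simpa [Matrix.mul_assoc] using hopt W' hW' 1 (one_mem _)
  have hright : ∀ Z' ∈ unitary (Matrix (Fin n) (Fin n) ℍ[ℝ]),
      reTr (Z' * (weightMat n m * B)) ≤ reTr (weightMat n m * B) := fun Z' hZ' => by
    have := hopt 1 (one_mem _) Z' hZ'
    rw [Matrix.one_mul, Matrix.mul_assoc, reTr_mul_comm, reTr_mul_comm B, Matrix.mul_assoc] at this
    exact this
  have herm := conjTranspose_eq_of_reTr_le hleft
  have hdiag := eq_zero_of_weightMat_hermitian herm (conjTranspose_eq_of_reTr_le hright)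
  have hentry : ∀ (p : Fin m) (q : Fin n), p.1 = q.1 →
      (B * weightMat n m) p p = ((p.1 + 1 : ℝ)⁻¹) • B p q := fun p q h => by
    rw [mul_weightMat_apply, dif_pos (h ▸ q.2)]
    congr 2
    exact Fin.ext h
  have hpos : ∀ p : Fin m, ((p.1 + 1 : ℝ)⁻¹) ≠ 0 := fun p => by positivity
  refine ⟨Wᴴ, Unitary.star_mem hW, B, Z, hZ, ?_, ?_, ?_, hdiag, ?_⟩
  · have h1 : Wᴴ * W = 1 := (Unitary.mem_iff.1 hW).1
    have h2 : Z * Zᴴ = 1 := (Unitary.mem_iff.1 hZ).2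
    rw [hB, Matrix.mul_assoc W, ← Matrix.mul_assoc, h1, Matrix.one_mul, Matrix.mul_assoc, h2,
      Matrix.mul_one]
  · intro p q
    by_cases hpq : p.1 = q.1
    · have h := congrFun (congrFun herm p) p
      rw [conjTranspose_apply, hentry p q hpq] at h
      have hI := congrArg QuaternionAlgebra.imI h
      have hJ := congrArg QuaternionAlgebra.imJ h
      have hK := congrArg QuaternionAlgebra.imK h
      simp only [Quaternion.imI_star, Quaternion.imJ_star, Quaternion.imK_star,
        Quaternion.imI_smul, Quaternion.imJ_smul, Quaternion.imK_smul, smul_eq_mul,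
        neg_eq_self, mul_eq_zero, hpos, false_or] at hI hJ hK
      exact ⟨hI, hJ, hK⟩
    · simp [hdiag p q hpq]
  · intro p q
    by_cases hpq : p.1 = q.1
    · have h := diag_re_nonneg_of_reTr_le hleft p
      rw [hentry p q hpq, Quaternion.re_smul, smul_eq_mul] at h
      exact nonneg_of_mul_nonneg_right h (by positivity)
    · simp [hdiag p q hpq]
  · refine diag_antitone_of_reTr_le fun σ τ => ?_
    have hτ := Unitary.star_mem (perm_mem_unitary τ)
    convert hopt _ (perm_mem_unitary σ) _ hτ using 3
    rw [star_eq_conjTranspose, conjTranspose_submatrix, conjTranspose_one]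
    apply Matrix.ext
    intro i j
    simp [submatrix_apply, mul_apply, one_apply]

end QuaternionSVD

section QuaternionDFT

open Quaternion

/-- The primitive root of unity `exp (-2πi / c)`. -/
def dftRoot (c : ℕ) : ℂ := (Complex.exp (2 * Real.pi * Complex.I / c))⁻¹

lemma dftRoot_isPrimitiveRoot {c : ℕ} (hc : c ≠ 0) : IsPrimitiveRoot (dftRoot c) c :=
  (Complex.isPrimitiveRoot_exp c hc).inv

lemma dftRoot_pow (c k : ℕ) : dftRoot c ^ k
    = Complex.exp (-((2 * Real.pi * k / c : ℝ) : ℂ) * Complex.I) := by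
  rw [dftRoot, ← Complex.exp_neg, ← Complex.exp_nat_mul]
  congr 1
  push_cast
  ring

lemma star_dftRoot (c : ℕ) : star (dftRoot c) = (dftRoot c)⁻¹ := by
  have h := dftRoot_pow c 1
  rw [pow_one] at h
  rw [h, ← Complex.exp_neg, Complex.star_def, ← Complex.exp_conj, map_mul, map_neg,
    Complex.conj_ofReal, Complex.conj_I, mul_neg]

/-- The unnormalized complex DFT matrix. -/
def dftC (c : ℕ) : Matrix (Fin c) (Fin c) ℂ := fun p q => dftRoot c ^ (p.1 * q.1)

lemma dftC_conjTranspose_mul (c : ℕ) : (dftC c)ᴴ * dftC c = (c : ℂ) • 1 := by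
  ext p q
  have hc : c ≠ 0 := by have := p.2; omega
  have hω := dftRoot_isPrimitiveRoot hc
  have h0 : dftRoot c ≠ 0 := hω.ne_zero hc
  simp only [mul_apply, conjTranspose_apply, dftC, star_pow, star_dftRoot]
  set x := (dftRoot c)⁻¹ ^ p.1 * dftRoot c ^ q.1 with hx
  have hterm : ∀ m : Fin c, (dftRoot c)⁻¹ ^ (m.1 * p.1) * dftRoot c ^ (m.1 * q.1) = x ^ m.1 := by
    intro m
    rw [hx, mul_pow, ← pow_mul, ← pow_mul, mul_comm p.1, mul_comm q.1]
  simp only [hterm]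
  rw [Fin.sum_univ_eq_sum_range (fun m => x ^ m) c]
  by_cases hpq : p = q
  · have : x = 1 := by rw [hx, hpq, inv_pow, inv_mul_cancel₀ (pow_ne_zero _ h0)]
    simp [this, hpq]
  · have hx1 : x ≠ 1 := by
      intro h
      rw [hx, inv_pow, inv_mul_eq_one₀ (pow_ne_zero _ h0)] at h
      exact hpq (Fin.ext (hω.pow_inj p.2 q.2 h))
    have hxc : x ^ c = 1 := by
      rw [hx, mul_pow, ← pow_mul, ← pow_mul, mul_comm p.1, mul_comm q.1, pow_mul, pow_mul, inv_pow,
        hω.pow_eq_one]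
      simp
    rw [geom_sum_eq hx1, hxc]
    simp [hpq]

lemma dftC_mul_conjTranspose {c : ℕ} : dftC c * (dftC c)ᴴ = (c : ℂ) • 1 := by
  rcases Nat.eq_zero_or_pos c with rfl | hc
  · ext p; exact p.elim0
  have hc' : (c : ℂ) ≠ 0 := by exact_mod_cast hc.ne'
  have h : ((c : ℂ)⁻¹ • (dftC c)ᴴ) * dftC c = 1 := by
    rw [smul_mul_assoc, dftC_conjTranspose_mul, smul_smul, inv_mul_cancel₀ hc', one_smul]
  rw [mul_eq_one_comm, mul_smul_comm, inv_smul_eq_iff₀ hc'] at h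
  exact h

lemma dftC_mul_dftC {c : ℕ} (l a b : Fin c) : dftC c l a * dftC c l b = dftC c l (a + b) := by
  have hc : c ≠ 0 := by have := l.2; omega
  have h : (dftRoot c ^ l.1) ^ c = 1 := by
    rw [← pow_mul, mul_comm, pow_mul, (dftRoot_isPrimitiveRoot hc).pow_eq_one, one_pow]
  simp only [dftC, pow_mul, Fin.val_add]
  rw [← pow_add, pow_eq_pow_mod _ h]

lemma dftC_revIdx {c : ℕ} (l m : Fin c) : dftC c l (revIdx m) = star (dftC c l m) := by
  have hc : c ≠ 0 := by have := l.2; omega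
  have h0 : dftRoot c ≠ 0 := (dftRoot_isPrimitiveRoot hc).ne_zero hc
  have h : (dftRoot c ^ l.1) ^ c = 1 := by
    rw [← pow_mul, mul_comm, pow_mul, (dftRoot_isPrimitiveRoot hc).pow_eq_one, one_pow]
  simp only [dftC, star_pow, star_dftRoot, revIdx]
  by_cases hm : m.1 = 0
  · simp [hm]
  · rw [dif_neg hm, inv_pow]
    refine eq_inv_of_mul_eq_one_left ?_
    rw [pow_mul, pow_mul, ← pow_add, Nat.sub_add_cancel m.2.le, h]

lemma UnitPure.mul_self {ν : ℍ[ℝ]} (hν : UnitPure ν) : ν * ν = -1 := by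
  have h := Quaternion.normSq_eq_norm_mul_self ν
  rw [hν.2, Quaternion.normSq_def', hν.1] at h
  have h0 := hν.1
  ext <;> simp [h0] <;> linarith

lemma UnitPure.star_eq {ν : ℍ[ℝ]} (hν : UnitPure ν) : star ν = -ν := by
  ext <;> simp [hν.1]

/-- The embedding `ℂ → ℍ` sending the imaginary unit to a unit pure quaternion. -/
def UnitPure.embed {ν : ℍ[ℝ]} (hν : UnitPure ν) : ℂ →ₐ[ℝ] ℍ[ℝ] :=
  Complex.liftAux ν hν.mul_self

lemma UnitPure.embed_apply {ν : ℍ[ℝ]} (hν : UnitPure ν) (z : ℂ) :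
    hν.embed z = (z.re : ℍ[ℝ]) + z.im • ν :=
  Complex.liftAux_apply _ _ _

lemma UnitPure.embed_star {ν : ℍ[ℝ]} (hν : UnitPure ν) (z : ℂ) :
    hν.embed (star z) = star (hν.embed z) := by
  simp [UnitPure.embed_apply, hν.star_eq]

lemma unitPure_of_sq {ν : ℍ[ℝ]} (h0 : ν.re = 0) (h : ν.imI ^ 2 + ν.imJ ^ 2 + ν.imK ^ 2 = 1) :
    UnitPure ν := by
  refine ⟨h0, ?_⟩
  have h1 := Quaternion.normSq_eq_norm_mul_self ν
  rw [Quaternion.normSq_def', h0] at h1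
  nlinarith [norm_nonneg ν]

lemma UnitPure.sq_eq {ν : ℍ[ℝ]} (hν : UnitPure ν) : ν.imI ^ 2 + ν.imJ ^ 2 + ν.imK ^ 2 = 1 := by
  have h := Quaternion.normSq_eq_norm_mul_self ν
  rw [hν.2, Quaternion.normSq_def', hν.1] at h
  linarith

@[simp] lemma re_mui (μ : ℍ[ℝ]) : (mui μ).re = 0 := rfl
@[simp] lemma imI_mui (μ : ℍ[ℝ]) : (mui μ).imI = μ.imI := rfl
@[simp] lemma imJ_mui (μ : ℍ[ℝ]) : (mui μ).imJ = -μ.imJ := rfl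
@[simp] lemma imK_mui (μ : ℍ[ℝ]) : (mui μ).imK = -μ.imK := rfl

@[simp] lemma re_muj (μ : ℍ[ℝ]) : (muj μ).re = 0 := rfl
@[simp] lemma imI_muj (μ : ℍ[ℝ]) : (muj μ).imI = -μ.imI := rfl
@[simp] lemma imJ_muj (μ : ℍ[ℝ]) : (muj μ).imJ = μ.imJ := rfl
@[simp] lemma imK_muj (μ : ℍ[ℝ]) : (muj μ).imK = -μ.imK := rfl

@[simp] lemma re_muk (μ : ℍ[ℝ]) : (muk μ).re = 0 := rfl
@[simp] lemma imI_muk (μ : ℍ[ℝ]) : (muk μ).imI = -μ.imI := rfl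
@[simp] lemma imJ_muk (μ : ℍ[ℝ]) : (muk μ).imJ = -μ.imJ := rfl
@[simp] lemma imK_muk (μ : ℍ[ℝ]) : (muk μ).imK = μ.imK := rfl

lemma UnitPure.mui {μ : ℍ[ℝ]} (hμ : UnitPure μ) : UnitPure (mui μ) :=
  unitPure_of_sq rfl (by simpa using hμ.sq_eq)

lemma UnitPure.muj {μ : ℍ[ℝ]} (hμ : UnitPure μ) : UnitPure (muj μ) :=
  unitPure_of_sq rfl (by simpa using hμ.sq_eq)

lemma UnitPure.muk {μ : ℍ[ℝ]} (hμ : UnitPure μ) : UnitPure (muk μ) :=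
  unitPure_of_sq rfl (by simpa using hμ.sq_eq)

lemma mul_qi {μ : ℍ[ℝ]} (hμ : UnitPure μ) : μ * qi = qi * mui μ := by
  have h := hμ.1
  ext <;> simp [h]

lemma mul_qj {μ : ℍ[ℝ]} (hμ : UnitPure μ) : μ * qj = qj * muj μ := by
  have h := hμ.1
  ext <;> simp [h]

lemma mul_qk {μ : ℍ[ℝ]} (hμ : UnitPure μ) : μ * qk = qk * muk μ := by
  have h := hμ.1
  ext <;> simp [h]

/-- The unnormalized QDFT matrix. -/
def Gq (ν : ℍ[ℝ]) (c : ℕ) : Matrix (Fin c) (Fin c) ℍ[ℝ] := (Real.sqrt c) • Fq ν c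

lemma Fq_eq_smul_Gq (ν : ℍ[ℝ]) (c : ℕ) : Fq ν c = (Real.sqrt c)⁻¹ • Gq ν c := by
  rcases Nat.eq_zero_or_pos c with rfl | hc
  · exact Subsingleton.elim _ _
  have : Real.sqrt c ≠ 0 := by positivity
  rw [Gq, smul_smul, inv_mul_cancel₀ this, one_smul]

lemma Gq_eq_map {ν : ℍ[ℝ]} (hν : UnitPure ν) (c : ℕ) : Gq ν c = (dftC c).map hν.embed := by
  apply Matrix.ext
  intro p q
  have hc : 0 < c := by have := p.2; omega
  have hs : Real.sqrt c ≠ 0 := by positivity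
  rw [map_apply, UnitPure.embed_apply, dftC, dftRoot_pow, ← Complex.ofReal_neg,
    Complex.exp_ofReal_mul_I_re, Complex.exp_ofReal_mul_I_im, Real.cos_neg, Real.sin_neg, Gq,
    Matrix.smul_apply, Fq, Quaternion.coe_mul_eq_smul, Quaternion.coe_mul_eq_smul, smul_smul,
    mul_one_div_cancel hs, one_smul]
  simp only [Nat.cast_mul, neg_smul, sub_eq_add_neg]

lemma Gq_conjTranspose {ν : ℍ[ℝ]} (hν : UnitPure ν) (c : ℕ) :
    (Gq ν c)ᴴ = ((dftC c)ᴴ).map hν.embed := by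
  rw [Gq_eq_map hν]
  apply Matrix.ext
  intro p q
  rw [conjTranspose_apply, map_apply, map_apply, conjTranspose_apply, hν.embed_star]

lemma smul_map_natCast_smul_one {ν : ℍ[ℝ]} (hν : UnitPure ν) (c : ℕ) :
    ((√c)⁻¹ * (√c)⁻¹) • ((c : ℂ) • (1 : Matrix (Fin c) (Fin c) ℂ)).map hν.embed = 1 := by
  rcases Nat.eq_zero_or_pos c with rfl | hc
  · exact Subsingleton.elim _ _
  have hs : (c : ℝ) ≠ 0 := by positivity
  apply Matrix.ext
  intro p q
  rw [Matrix.smul_apply, map_apply, Matrix.smul_apply, smul_eq_mul, map_mul, map_natCast,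
    ← mul_inv, Real.mul_self_sqrt (Nat.cast_nonneg c)]
  rw [show ((c : ℕ) : ℍ[ℝ]) = ((c : ℝ) : ℍ[ℝ]) from rfl, Quaternion.coe_mul_eq_smul, smul_smul,
    inv_mul_cancel₀ hs, one_smul, one_apply, one_apply]
  split_ifs <;> simp

lemma Fq_conjTranspose_mul {ν : ℍ[ℝ]} (hν : UnitPure ν) (c : ℕ) : (Fq ν c)ᴴ * Fq ν c = 1 := by
  rw [Fq_eq_smul_Gq, conjTranspose_smul, smul_mul_smul_comm, Gq_conjTranspose hν, Gq_eq_map hν,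
    ← Matrix.map_mul, dftC_conjTranspose_mul]
  exact smul_map_natCast_smul_one hν c

lemma Fq_mul_conjTranspose {ν : ℍ[ℝ]} (hν : UnitPure ν) (c : ℕ) : Fq ν c * (Fq ν c)ᴴ = 1 := by
  rw [Fq_eq_smul_Gq, conjTranspose_smul, smul_mul_smul_comm, Gq_conjTranspose hν, Gq_eq_map hν,
    ← Matrix.map_mul, dftC_mul_conjTranspose]
  exact smul_map_natCast_smul_one hν c

end QuaternionDFT
section TensorDFT

open Quaternion

variable {a b r c : ℕ}

lemma fftT_apply (μ : ℍ[ℝ]) (A : QTensor a b c) (p : Fin a) (q : Fin b) :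
    fftT μ A p q = Gq μ c *ᵥ A p q := by
  funext l
  simp only [fftT, mulVec, dotProduct, Gq, Matrix.smul_apply, smul_mul_assoc,
    Quaternion.coe_mul_eq_smul, Finset.smul_sum]

lemma Gq_apply_mul {μ ν : ℍ[ℝ]} (hμ : UnitPure μ) (hν : UnitPure ν) {x : ℍ[ℝ]}
    (h : μ * x = x * ν) (l m : Fin c) : Gq μ c l m * x = x * Gq ν c l m := by
  rw [Gq_eq_map hμ, Gq_eq_map hν, map_apply, map_apply, UnitPure.embed_apply,
    UnitPure.embed_apply, add_mul, mul_add, Quaternion.coe_commutes, smul_mul_assoc,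
    mul_smul_comm, h]

lemma Gq_mulVec_smul {μ ν : ℍ[ℝ]} (hμ : UnitPure μ) (hν : UnitPure ν) {x : ℍ[ℝ]}
    (h : μ * x = x * ν) (v : Fin c → ℍ[ℝ]) : Gq μ c *ᵥ (x • v) = x • (Gq ν c *ᵥ v) := by
  funext l
  simp only [mulVec, dotProduct, Pi.smul_apply, smul_eq_mul, ← mul_assoc, Gq_apply_mul hμ hν h,
    Finset.mul_sum]

lemma mulVec_mul_right (M : Matrix (Fin a) (Fin b) ℍ[ℝ]) (v : Fin b → ℍ[ℝ]) (x : ℍ[ℝ]) :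
    (M *ᵥ fun m => v m * x) = fun l => (M *ᵥ v) l * x := by
  funext l
  simp only [mulVec, dotProduct, ← mul_assoc, Finset.sum_mul]

lemma Gq_mul_Tm {ν : ℍ[ℝ]} (hν : UnitPure ν) (μ : ℍ[ℝ]) : Gq ν c * Tm ν μ c = Gq μ c := by
  rw [Gq, Gq, Tm, smul_mul_assoc, ← Matrix.mul_assoc, Fq_mul_conjTranspose hν, Matrix.one_mul]

lemma Gq_mul_Tm_conjTranspose {μ : ℍ[ℝ]} (hμ : UnitPure μ) (ν : ℍ[ℝ]) :
    Gq μ c * (Tm ν μ c)ᴴ = Gq ν c := by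
  rw [Gq, Gq, Tm, conjTranspose_mul, conjTranspose_conjTranspose, smul_mul_assoc,
    ← Matrix.mul_assoc, Fq_mul_conjTranspose hμ, Matrix.one_mul]

/-- Circular convolution of a real vector with a quaternion vector. -/
def circConv (x : Fin c → ℝ) (v : Fin c → ℍ[ℝ]) : Fin c → ℍ[ℝ] :=
  fun l => ∑ m, (x (l - m) : ℍ[ℝ]) * v m

lemma Gq_mulVec_circConv {ν : ℍ[ℝ]} (hν : UnitPure ν) (x : Fin c → ℝ) (v : Fin c → ℍ[ℝ])
    (l : Fin c) :
    (Gq ν c *ᵥ circConv x v) l = (Gq ν c *ᵥ fun m => (x m : ℍ[ℝ])) l * (Gq ν c *ᵥ v) l := by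
  have : NeZero c := ⟨by have := l.2; omega⟩
  have hG : ∀ k m : Fin c, Gq ν c l (k + m) = Gq ν c l k * Gq ν c l m := by
    intro k m
    simp only [Gq_eq_map hν, map_apply, ← dftC_mul_dftC, map_mul]
  simp only [mulVec, dotProduct, circConv, Finset.mul_sum]
  rw [Finset.sum_comm]
  refine Finset.sum_congr rfl fun m _ => ?_
  rw [Finset.sum_mul, ← Equiv.sum_comp (Equiv.addRight m)]
  refine Finset.sum_congr rfl fun k _ => ?_
  rw [Equiv.coe_addRight, add_sub_cancel_right, hG, mul_assoc, mul_assoc,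
    ← mul_assoc (Gq ν c l m), ← Quaternion.coe_commutes, mul_assoc]

lemma Gq_mulVec_revIdx {ν : ℍ[ℝ]} (hν : UnitPure ν) (x : Fin c → ℝ) (l : Fin c) :
    (Gq ν c *ᵥ fun m => (x (revIdx m) : ℍ[ℝ])) l
      = star ((Gq ν c *ᵥ fun m => (x m : ℍ[ℝ])) l) := by
  have hrev : Function.Involutive (revIdx : Fin c → Fin c) := by
    intro m
    unfold revIdx
    ext
    have := m.2
    split_ifs <;> simp_all <;> omega
  simp only [mulVec, dotProduct, star_sum]
  rw [← Equiv.sum_comp hrev.toPerm]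
  refine Finset.sum_congr rfl fun k _ => ?_
  rw [Function.Involutive.coe_toPerm, hrev k, Gq_eq_map hν, map_apply, map_apply, dftC_revIdx,
    hν.embed_star, StarMul.star_mul, Quaternion.star_coe, Quaternion.coe_commutes]

lemma circ_mul_apply (A : QTensor a r c) (M : Matrix (Fin c × Fin r) (Fin b) ℍ[ℝ])
    (l : Fin c) (p : Fin a) (q : Fin b) :
    (circ A * M) (l, p) q = ∑ s, ∑ m, A p s (l - m) * M (m, s) q := by
  rw [mul_apply, Fintype.sum_prod_type, Finset.sum_comm]
  rfl

lemma kronecker_one_mul_unfold3 (T : Matrix (Fin c) (Fin c) ℍ[ℝ]) (B : QTensor r b c)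
    (m : Fin c) (s : Fin r) (q : Fin b) :
    ((T ⊗ₖ (1 : Matrix (Fin r) (Fin r) ℍ[ℝ])) * unfold3 B) (m, s) q = (T *ᵥ B s q) m := by
  rw [mul_apply, Fintype.sum_prod_type]
  simp [kroneckerMap_apply, one_apply, unfold3, mulVec, dotProduct]

lemma gQt_eq_sum (μ : ℍ[ℝ]) (A : QTensor a r c) (B : QTensor r b c) (p : Fin a) (q : Fin b) :
    gQt μ A B p q = ∑ s, (circConv (fun m => (A p s m).re) (B s q)
      + qi • circConv (fun m => (A p s m).imI) (Tm (mui μ) μ c *ᵥ B s q)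
      + qj • circConv (fun m => (A p s m).imJ) (Tm (muj μ) μ c *ᵥ B s q)
      + qk • circConv (fun m => (A p s m).imK) (Tm (muk μ) μ c *ᵥ B s q)) := by
  funext l
  simp only [gQt, fold3, Matrix.add_mul, Matrix.smul_mul, Matrix.mul_assoc, Matrix.add_apply,
    Matrix.smul_apply, circ_mul_apply, kronecker_one_mul_unfold3, Finset.sum_apply,
    Pi.add_apply, Pi.smul_apply, circConv, Finset.sum_add_distrib, Finset.smul_sum]
  rfl

lemma eq_components (x : ℍ[ℝ]) :
    x = (x.re : ℍ[ℝ]) + qi * (x.imI : ℍ[ℝ]) + qj * (x.imJ : ℍ[ℝ]) + qk * (x.imK : ℍ[ℝ]) := by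
  ext <;> simp

lemma Gq_mulVec_eq {μ : ℍ[ℝ]} (hμ : UnitPure μ) (v : Fin c → ℍ[ℝ]) (l : Fin c) :
    (Gq μ c *ᵥ v) l = (Gq μ c *ᵥ fun m => ((v m).re : ℍ[ℝ])) l
      + qi * (Gq (mui μ) c *ᵥ fun m => ((v m).imI : ℍ[ℝ])) l
      + qj * (Gq (muj μ) c *ᵥ fun m => ((v m).imJ : ℍ[ℝ])) l
      + qk * (Gq (muk μ) c *ᵥ fun m => ((v m).imK : ℍ[ℝ])) l := by
  have hv : v = (fun m => ((v m).re : ℍ[ℝ])) + qi • (fun m => ((v m).imI : ℍ[ℝ]))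
      + qj • (fun m => ((v m).imJ : ℍ[ℝ])) + qk • (fun m => ((v m).imK : ℍ[ℝ])) :=
    funext fun m => eq_components (v m)
  conv_lhs => rw [hv]
  rw [mulVec_add, mulVec_add, mulVec_add, Gq_mulVec_smul hμ hμ.mui (mul_qi hμ),
    Gq_mulVec_smul hμ hμ.muj (mul_qj hμ), Gq_mulVec_smul hμ hμ.muk (mul_qk hμ)]
  rfl

lemma fslice_fftT_gQt {μ : ℍ[ℝ]} (hμ : UnitPure μ) (A : QTensor a r c) (B : QTensor r b c)
    (l : Fin c) :
    fslice (fftT μ (gQt μ A B)) l = fslice (fftT μ A) l * fslice (fftT μ B) l := by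
  apply Matrix.ext
  intro p q
  simp only [fslice, mul_apply, fftT_apply, gQt_eq_sum, mulVec_sum, Finset.sum_apply]
  refine Finset.sum_congr rfl fun s _ => ?_
  rw [mulVec_add, mulVec_add, mulVec_add, Gq_mulVec_smul hμ hμ.mui (mul_qi hμ),
    Gq_mulVec_smul hμ hμ.muj (mul_qj hμ), Gq_mulVec_smul hμ hμ.muk (mul_qk hμ),
    Gq_mulVec_eq hμ (A p s)]
  simp only [Pi.add_apply, Pi.smul_apply, Gq_mulVec_circConv hμ, Gq_mulVec_circConv hμ.mui,
    Gq_mulVec_circConv hμ.muj, Gq_mulVec_circConv hμ.muk, mulVec_mulVec, Gq_mul_Tm hμ.mui,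
    Gq_mul_Tm hμ.muj, Gq_mul_Tm hμ.muk, smul_eq_mul, add_mul, mul_assoc]

lemma conjT_eq (μ : ℍ[ℝ]) (A : QTensor a b c) (p : Fin a) (q : Fin b) :
    conjT μ A q p = (fun m => ((A p q (revIdx m)).re : ℍ[ℝ]))
      - (fun m => ((Tm (mui μ) μ c)ᴴ *ᵥ fun m => ((A p q (revIdx m)).imI : ℍ[ℝ])) m * qi)
      - (fun m => ((Tm (muj μ) μ c)ᴴ *ᵥ fun m => ((A p q (revIdx m)).imJ : ℍ[ℝ])) m * qj)
      - (fun m => ((Tm (muk μ) μ c)ᴴ *ᵥ fun m => ((A p q (revIdx m)).imK : ℍ[ℝ])) m * qk) := by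
  funext l
  simp only [conjT, fold3, Matrix.sub_apply, rmulM, kronecker_one_mul_unfold3, Pi.sub_apply]
  rfl

lemma fslice_fftT_conjT {μ : ℍ[ℝ]} (hμ : UnitPure μ) (A : QTensor a b c) (l : Fin c) :
    fslice (fftT μ (conjT μ A)) l = (fslice (fftT μ A) l)ᴴ := by
  apply Matrix.ext
  intro q p
  simp only [fslice, conjTranspose_apply, fftT_apply]
  rw [conjT_eq, mulVec_sub, mulVec_sub, mulVec_sub, Gq_mulVec_eq hμ (A p q)]
  simp only [mulVec_mul_right, mulVec_mulVec, Gq_mul_Tm_conjTranspose hμ, Pi.sub_apply]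
  rw [Gq_mulVec_revIdx hμ fun m => (A p q m).re, Gq_mulVec_revIdx hμ.mui fun m => (A p q m).imI,
    Gq_mulVec_revIdx hμ.muj fun m => (A p q m).imJ, Gq_mulVec_revIdx hμ.muk fun m => (A p q m).imK]
  simp only [star_add, StarMul.star_mul, star_qi, star_qj, star_qk, mul_neg, sub_eq_add_neg]

/-- The inverse QDFT along mode 3. -/
def ifftT (μ : ℍ[ℝ]) (X : QTensor a b c) : QTensor a b c :=
  fun p q => (√c)⁻¹ • ((Fq μ c)ᴴ *ᵥ X p q)

lemma fftT_ifftT {μ : ℍ[ℝ]} (hμ : UnitPure μ) (X : QTensor a b c) : fftT μ (ifftT μ X) = X := by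
  funext p q l
  have hs : √(c : ℝ) ≠ 0 := by have := l.2; rw [Real.sqrt_ne_zero']; norm_cast; omega
  rw [fftT_apply, ifftT, mulVec_smul, mulVec_mulVec, Gq, smul_mul_assoc,
    Fq_mul_conjTranspose hμ, smul_mulVec, smul_smul, inv_mul_cancel₀ hs, one_smul, one_mulVec]

lemma ifftT_fftT {μ : ℍ[ℝ]} (hμ : UnitPure μ) (A : QTensor a b c) : ifftT μ (fftT μ A) = A := by
  funext p q l
  have hs : √(c : ℝ) ≠ 0 := by have := l.2; rw [Real.sqrt_ne_zero']; norm_cast; omega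
  rw [ifftT, fftT_apply, mulVec_mulVec, Gq, mul_smul_comm,
    Fq_conjTranspose_mul hμ, smul_mulVec, smul_smul, inv_mul_cancel₀ hs, one_smul, one_mulVec]

lemma fslice_fftT_ifftT {μ : ℍ[ℝ]} (hμ : UnitPure μ)
    (M : Fin c → Matrix (Fin a) (Fin b) ℍ[ℝ]) (l : Fin c) :
    fslice (fftT μ (ifftT μ fun p q l => M l p q)) l = M l := by
  rw [fftT_ifftT hμ]
  rfl

lemma eq_of_fslice_fftT {μ : ℍ[ℝ]} (hμ : UnitPure μ) {A B : QTensor a b c}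
    (h : ∀ l, fslice (fftT μ A) l = fslice (fftT μ B) l) : A = B := by
  rw [← ifftT_fftT hμ A, ← ifftT_fftT hμ B]
  congr 1
  funext p q l
  exact congrFun (congrFun (h l) p) q

lemma fslice_fftT_idT {μ : ℍ[ℝ]} (hμ : UnitPure μ) (l : Fin c) :
    fslice (fftT μ (idT a c)) l = 1 := by
  have : NeZero c := ⟨by have := l.2; omega⟩
  apply Matrix.ext
  intro p q
  have hG : Gq μ c l 0 = 1 := by simp [Gq_eq_map hμ, dftC]
  rw [fslice, fftT_apply, mulVec, dotProduct, Finset.sum_eq_single 0]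
  · simp [hG, idT, one_apply]
  · intro m _ hm
    simp [idT, hm]
  · simp

lemma unitaryT_of_fslice_fftT {μ : ℍ[ℝ]} (hμ : UnitPure μ) {U : QTensor a a c}
    (hU : ∀ l, fslice (fftT μ U) l ∈ unitary (Matrix (Fin a) (Fin a) ℍ[ℝ])) :
    unitaryT μ U := by
  constructor <;> refine eq_of_fslice_fftT hμ fun l => ?_ <;>
    rw [fslice_fftT_gQt hμ, fslice_fftT_conjT hμ, fslice_fftT_idT hμ, ← star_eq_conjTranspose]
  · exact (Unitary.mem_iff.1 (hU l)).1
  · exact (Unitary.mem_iff.1 (hU l)).2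

lemma coe_sum_norm_sq (v : Fin c → ℍ[ℝ]) : ((∑ m, ‖v m‖ ^ 2 : ℝ) : ℍ[ℝ]) = star v ⬝ᵥ v := by
  simp only [dotProduct, Pi.star_apply, Quaternion.star_mul_self, Quaternion.normSq_eq_norm_mul_self,
    ← sq]
  exact map_sum (algebraMap ℝ ℍ[ℝ]) (fun m => ‖v m‖ ^ 2) Finset.univ

lemma sum_norm_sq_Gq_mulVec {μ : ℍ[ℝ]} (hμ : UnitPure μ) (v : Fin c → ℍ[ℝ]) :
    ∑ l, ‖(Gq μ c *ᵥ v) l‖ ^ 2 = c * ∑ m, ‖v m‖ ^ 2 := by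
  apply Quaternion.coe_injective
  rw [Quaternion.coe_mul, coe_sum_norm_sq, coe_sum_norm_sq, star_mulVec, dotProduct_mulVec,
    vecMul_vecMul, Gq, conjTranspose_smul, smul_mul_smul_comm, Fq_conjTranspose_mul hμ,
    star_trivial (√(c : ℝ)), Real.mul_self_sqrt (Nat.cast_nonneg c), vecMul_smul, vecMul_one,
    smul_dotProduct, Quaternion.coe_mul_eq_smul]

lemma reTr_conjTranspose_mul_self (M : Matrix (Fin a) (Fin b) ℍ[ℝ]) :
    reTr (Mᴴ * M) = ∑ p, ∑ q, ‖M p q‖ ^ 2 := by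
  rw [Finset.sum_comm]
  simp only [reTr, mul_apply, conjTranspose_apply, re_sum, Quaternion.star_mul_self,
    Quaternion.re_coe, Quaternion.normSq_eq_norm_mul_self, ← sq]

lemma reTr_unitary_mul_unitary {U : Matrix (Fin a) (Fin a) ℍ[ℝ]}
    {V : Matrix (Fin b) (Fin b) ℍ[ℝ]} (hU : U ∈ unitary (Matrix (Fin a) (Fin a) ℍ[ℝ]))
    (hV : V ∈ unitary (Matrix (Fin b) (Fin b) ℍ[ℝ])) (S : Matrix (Fin a) (Fin b) ℍ[ℝ]) :
    reTr ((U * S * Vᴴ)ᴴ * (U * S * Vᴴ)) = reTr (Sᴴ * S) := by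
  have hU' : Uᴴ * U = 1 := (Unitary.mem_iff.1 hU).1
  have hV' : Vᴴ * V = 1 := (Unitary.mem_iff.1 hV).1
  calc reTr ((U * S * Vᴴ)ᴴ * (U * S * Vᴴ))
      = reTr (V * (Sᴴ * ((Uᴴ * U) * (S * Vᴴ)))) := by
        simp only [conjTranspose_mul, conjTranspose_conjTranspose, Matrix.mul_assoc]
    _ = reTr (Sᴴ * S) := by
        rw [hU', Matrix.one_mul, reTr_mul_comm, Matrix.mul_assoc, Matrix.mul_assoc, hV',
          Matrix.mul_one]

lemma sum_reTr_fslice_fftT {μ : ℍ[ℝ]} (hμ : UnitPure μ) (A : QTensor a b c) :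
    ∑ l, reTr ((fslice (fftT μ A) l)ᴴ * fslice (fftT μ A) l)
      = c * ∑ p, ∑ q, ∑ l, ‖A p q l‖ ^ 2 := by
  simp only [reTr_conjTranspose_mul_self, fslice, fftT_apply]
  rw [Finset.sum_comm, Finset.mul_sum]
  refine Finset.sum_congr rfl fun p _ => ?_
  rw [Finset.sum_comm, Finset.mul_sum]
  exact Finset.sum_congr rfl fun q _ => sum_norm_sq_Gq_mulVec hμ _

lemma frobT_eq_of_reTr {μ : ℍ[ℝ]} (hμ : UnitPure μ) {A B : QTensor a b c}
    (h : ∀ l, reTr ((fslice (fftT μ A) l)ᴴ * fslice (fftT μ A) l)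
      = reTr ((fslice (fftT μ B) l)ᴴ * fslice (fftT μ B) l)) : frobT A = frobT B := by
  rcases Nat.eq_zero_or_pos c with rfl | hc
  · simp [frobT]
  have h1 := sum_reTr_fslice_fftT hμ A
  rw [Finset.sum_congr rfl fun l _ => h l, sum_reTr_fslice_fftT hμ B] at h1
  rw [frobT, frobT, mul_left_cancel₀ (by positivity) h1]

lemma fDiag_ifftT (μ : ℍ[ℝ]) {X : QTensor a b c} (hX : fDiag X) : fDiag (ifftT μ X) := by
  intro p q l hpq
  rw [ifftT, show X p q = 0 from funext fun m => hX p q m hpq, mulVec_zero, smul_zero]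
  rfl

end TensorDFT

/-- existence of the gQt-SVD. -/
theorem gQt_svd {n₁ n₂ n₃ : ℕ} (μ : Quaternion ℝ) (hμ : UnitPure μ)
    (A : QTensor n₁ n₂ n₃) :
    ∃ (U : QTensor n₁ n₁ n₃) (S : QTensor n₁ n₂ n₃) (V : QTensor n₂ n₂ n₃),
      unitaryT μ U ∧ unitaryT μ V ∧ fDiag S ∧
      A = gQt μ U (gQt μ S (conjT μ V)) ∧
      frobT A = frobT S ∧
      (∀ (l : Fin n₃) (p : Fin n₁) (q : Fin n₂),
          (fftT μ S p q l).imI = 0 ∧ (fftT μ S p q l).imJ = 0 ∧ (fftT μ S p q l).imK = 0) ∧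
      (∀ (l : Fin n₃) (p : Fin n₁) (q : Fin n₂), 0 ≤ (fftT μ S p q l).re) ∧
      (∀ (l : Fin n₃) (p : Fin n₁) (q : Fin n₂), p.1 ≠ q.1 → fftT μ S p q l = 0) ∧
      (∀ (l : Fin n₃) (p p' : Fin n₁) (q q' : Fin n₂),
          p.1 = q.1 → p'.1 = q'.1 → p.1 ≤ p'.1 →
          (fftT μ S p' q' l).re ≤ (fftT μ S p q l).re) := by
  choose U hU S V hV hA him hre hdiag hmono using
    fun l => exists_quaternion_svd (fslice (fftT μ A) l)
  refine ⟨ifftT μ fun p q l => U l p q, ifftT μ fun p q l => S l p q,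
    ifftT μ fun p q l => V l p q, ?_, ?_, ?_, ?_, ?_, ?_⟩
  · exact unitaryT_of_fslice_fftT hμ fun l => by rw [fslice_fftT_ifftT hμ]; exact hU l
  · exact unitaryT_of_fslice_fftT hμ fun l => by rw [fslice_fftT_ifftT hμ]; exact hV l
  · exact fDiag_ifftT μ fun p q l hpq => hdiag l p q hpq
  · refine eq_of_fslice_fftT hμ fun l => ?_
    rw [fslice_fftT_gQt hμ, fslice_fftT_gQt hμ, fslice_fftT_conjT hμ, fslice_fftT_ifftT hμ,
      fslice_fftT_ifftT hμ, fslice_fftT_ifftT hμ, hA l, Matrix.mul_assoc]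
  · refine frobT_eq_of_reTr hμ fun l => ?_
    rw [fslice_fftT_ifftT hμ, hA l, reTr_unitary_mul_unitary (hU l) (hV l)]
  · rw [fftT_ifftT hμ]
    exact ⟨him, hre, hdiag, hmono⟩

end QTpaper
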